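/- arXiv:2209.10323 — 3 statements merged into one kernel-verified Lean document; each statement's English description precedes it below -/
import Mathlib

section
/- Let (N,M₀) be a safe Petri net with unfolding U and let B⊆2^P be a reachability-closed set of bad markings. A finite configuration C of U is free if and only if either (a) there exists a finite ⊆-maximal configuration C' of U with C⊆C' and Mark(C')∉B, or (b) there exist finite configurations C₁,C₂ of U such that (1) C⊆C₁⊆C₂ and Mark(C₂)∉B, (2) Mark(C₁)=Mark(C₂), and (3) every event e of U enabled by C₁ has a spoiler in C₂. -/
/-- A net `N = (P,T,F)`: the flow relation is split into its
place-to-transition part `pt` and transition-to-place part `tp`. -/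
structure Net (P T : Type) where
  pt : P → T → Prop
  tp : T → P → Prop

namespace Net

variable {P T : Type} (N : Net P T)

/-- Preset of a transition: `•t`. -/
def preT (t : T) : Set P := {p | N.pt p t}
/-- Postset of a transition: `t•`. -/
def postT (t : T) : Set P := {p | N.tp t p}
/-- Preset of a place: `•p`. -/
def preP (p : P) : Set T := {t | N.tp t p}
/-- Postset of a place: `p•`. -/
def postP (p : P) : Set T := {t | N.pt p t}

/-- Transition `t` is enabled at marking `M` iff `•t ⊆ M`. -/
def enabled (M : Set P) (t : T) : Prop := N.preT t ⊆ M
/-- Firing `t` at `M` yields `(M \ •t) ∪ t•`. -/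
def fire (M : Set P) (t : T) : Set P := (M \ N.preT t) ∪ N.postT t
/-- One firing step between markings. -/
def stepRel (M M' : Set P) : Prop := ∃ t : T, N.enabled M t ∧ M' = N.fire M t
/-- Reachability between markings (finite firing sequences). -/
def reach (M M' : Set P) : Prop := Relation.ReflTransGen N.stepRel M M'

/-- `(N, M₀)` is safe. -/
def safe (M₀ : Set P) : Prop :=
  ∀ M : Set P, N.reach M₀ M → ∀ t : T, N.enabled M t → M ∩ N.postT t ⊆ N.preT t

/-- `FiringSeq M l M'`: the sequence `l` of transitions can fire from `M`, ending in `M'`. -/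
inductive FiringSeq : Set P → List T → Set P → Prop
  | nil (M : Set P) : FiringSeq M [] M
  | cons {M : Set P} (t : T) {l : List T} {M' : Set P} :
      N.enabled M t → FiringSeq (N.fire M t) l M' → FiringSeq M (t :: l) M'

/-- The underlying edge relation of the flow, on nodes `P ⊕ T`. -/
def edge : (P ⊕ T) → (P ⊕ T) → Prop
  | Sum.inl p, Sum.inr t => N.pt p t
  | Sum.inr t, Sum.inl p => N.tp t p
  | _, _ => False

/-- Causality: `x < y` via a nonempty directed path. -/
def ltN (x y : P ⊕ T) : Prop := Relation.TransGen N.edge x y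
/-- `x ≤ y` iff `x < y` or `x = y`. -/
def leN (x y : P ⊕ T) : Prop := N.ltN x y ∨ x = y

/-- Direct conflict of transitions: `•u ∩ •v ≠ ∅`. -/
def dirConflict (u v : T) : Prop := (N.preT u ∩ N.preT v).Nonempty
/-- Conflict of nodes `x # y`. -/
def conflict (x y : P ⊕ T) : Prop :=
  ∃ u v : T, u ≠ v ∧ N.leN (Sum.inr u) x ∧ N.leN (Sum.inr v) y ∧ N.dirConflict u v
/-- Concurrency of nodes. -/
def concurrent (x y : P ⊕ T) : Prop :=
  ¬ N.leN x y ∧ ¬ N.leN y x ∧ ¬ N.conflict x y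
/-- A co-set: a set of pairwise concurrent places (conditions). -/
def coset (S : Set P) : Prop :=
  ∀ b ∈ S, ∀ b' ∈ S, b ≠ b' → N.concurrent (Sum.inl b) (Sum.inl b')

end Net

/-- An occurrence net `O = (B, E, F, c₀)`: conditions `B`, events `E`. -/
structure OccNet (B E : Type) extends Net B E where
  c₀ : Set B
  lt_irrefl : ∀ x : B ⊕ E, ¬ toNet.ltN x x
  pre_subsingleton : ∀ b : B, (toNet.preP b).Subsingleton
  mem_c₀_iff : ∀ b : B, b ∈ c₀ ↔ toNet.preP b = ∅
  no_self_conflict : ∀ e : E, ¬ toNet.conflict (Sum.inr e) (Sum.inr e)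
  finite_past : ∀ e : E, {x : B ⊕ E | toNet.leN x (Sum.inr e)}.Finite

namespace OccNet

variable {B E : Type} (O : OccNet B E)

/-- A configuration: a causally closed, conflict-free set of events. -/
def config (C : Set E) : Prop :=
  (∀ e ∈ C, ∀ e' : E, O.toNet.ltN (Sum.inr e') (Sum.inr e) → e' ∈ C) ∧
  (∀ e ∈ C, ∀ e' ∈ C, ¬ O.toNet.conflict (Sum.inr e) (Sum.inr e'))

/-- A run: a `⊆`-maximal configuration. -/
def run (ω : Set E) : Prop :=
  O.config ω ∧ ∀ C : Set E, O.config C → ω ⊆ C → C = ω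

/-- `cut C = (c₀ ∪ C•) \ •C`. -/
def cut (C : Set E) : Set B :=
  (O.c₀ ∪ {b | ∃ e ∈ C, O.toNet.tp e b}) \ {b | ∃ e ∈ C, O.toNet.pt b e}

/-- Event `e` is enabled by configuration `C`. -/
def enabledBy (C : Set E) (e : E) : Prop := e ∉ C ∧ O.config (C ∪ {e})

/-- `crest C`: the `<`-maximal events of `C`. -/
def crest (C : Set E) : Set E :=
  {e | e ∈ C ∧ ¬ ∃ e' ∈ C, O.toNet.ltN (Sum.inr e) (Sum.inr e')}

/-- The stump `⌊e⌋ = {e' : e' < e}` of an event. -/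
def stump (e : E) : Set E := {e' | O.toNet.ltN (Sum.inr e') (Sum.inr e)}

/-- `spoiler e e'`: `e'` is a spoiler of `e`, i.e. `•e' ∩ •e ≠ ∅`. -/
def spoiler (e e' : E) : Prop := (O.toNet.preT e' ∩ O.toNet.preT e).Nonempty

/-- An event is unchallenged iff no other event shares a precondition with it. -/
def unchallenged (e : E) : Prop :=
  ¬ ∃ e' : E, e' ≠ e ∧ (O.toNet.preT e' ∩ O.toNet.preT e).Nonempty

/-- A configuration is shaved iff its crest contains no unchallenged event. -/
def shaved (C : Set E) : Prop := ∀ e ∈ O.crest C, ¬ O.unchallenged e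

/-- Strict `C`-conflict `e #^C e'`: `e ≠ e'`, `•e ∩ •e' ≠ ∅`, and `⌊e'⌋ ⊆ C`. -/
def strictConflict (C : Set E) (e e' : E) : Prop :=
  e ≠ e' ∧ (O.toNet.preT e ∩ O.toNet.preT e').Nonempty ∧ O.stump e' ⊆ C

/-- Decisional height `δ(C)`: the number of events of `C` in strict `C`-conflict
with some event. -/
noncomputable def dHeight (C : Set E) : ℕ :=
  {e | e ∈ C ∧ ∃ e' : E, O.strictConflict C e e'}.ncard

end OccNet

/-- The unfolding `U = U(N, M₀)` of a Petri net `(N, M₀)`: an occurrence net with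
conditions `B` and events `E`, together with the folding map (`fB` on conditions,
`fE` on events), satisfying the defining properties of the inductive construction:
the initial cut corresponds bijectively to `M₀`; the preset of an event `e` is a
co-set folded bijectively onto `•f(e)` and its postset is folded bijectively onto
`f(e)•`; events are uniquely determined by (preset, label) and exist for every
co-set folding onto some `•t`; conditions are uniquely determined by
(producing event, label). -/
structure Unfolding (P T : Type) (N : Net P T) (M₀ : Set P) (B E : Type) where
  occ : OccNet B E
  fB : B → P
  fE : E → T
  init_bij : Set.BijOn fB occ.c₀ M₀
  pre_coset : ∀ e : E, occ.toNet.coset (occ.toNet.preT e)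
  pre_bij : ∀ e : E, Set.BijOn fB (occ.toNet.preT e) (N.preT (fE e))
  post_bij : ∀ e : E, Set.BijOn fB (occ.toNet.postT e) (N.postT (fE e))
  event_unique : ∀ e e' : E,
    occ.toNet.preT e = occ.toNet.preT e' → fE e = fE e' → e = e'
  event_exists : ∀ (S : Set B) (t : T), occ.toNet.coset S → Set.BijOn fB S (N.preT t) →
    ∃ e : E, occ.toNet.preT e = S ∧ fE e = t
  cond_unique : ∀ b b' : B,
    occ.toNet.preP b = occ.toNet.preP b' → fB b = fB b' → b = b'

/-- `Bad` is reachability-closed: `M ∈ Bad` and `M → M'` imply `M' ∈ Bad`. -/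
def ReachClosed {P T : Type} (N : Net P T) (Bad : Set (Set P)) : Prop :=
  ∀ M ∈ Bad, ∀ M' : Set P, N.reach M M' → M' ∈ Bad

namespace Unfolding

variable {P T B E : Type} {N : Net P T} {M₀ : Set P} (U : Unfolding P T N M₀ B E)

/-- `Mark C = f(cut C)`. -/
def Mark (C : Set E) : Set P := U.fB '' U.occ.cut C

/-- A finite configuration is doomed iff every run extending it contains a finite
configuration (extending it) whose marking is bad. -/
def doomed (Bad : Set (Set P)) (C : Set E) : Prop :=
  ∀ ω : Set E, U.occ.run ω → C ⊆ ω →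
    ∃ C' : Set E, C'.Finite ∧ U.occ.config C' ∧ C ⊆ C' ∧ C' ⊆ ω ∧ U.Mark C' ∈ Bad

/-- A configuration is free iff it is not doomed. -/
def free (Bad : Set (Set P)) (C : Set E) : Prop := ¬ U.doomed Bad C

/-- A finite configuration is minimally doomed iff it is doomed and no proper
sub-configuration of it is doomed. -/
def minDoomed (Bad : Set (Set P)) (C : Set E) : Prop :=
  C.Finite ∧ U.occ.config C ∧ U.doomed Bad C ∧
  ∀ C' : Set E, C' ⊂ C → U.occ.config C' → ¬ U.doomed Bad C'

/-- A (finite) prefix of the unfolding: a finite, causally closed set of events. -/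
def isPrefix (E' : Set E) : Prop :=
  E'.Finite ∧ ∀ e ∈ E', ∀ e' : E, U.occ.toNet.ltN (Sum.inr e') (Sum.inr e) → e' ∈ E'

/-- A complete prefix `Π₀` of the unfolding. -/
def isCompletePrefix (E' : Set E) : Prop :=
  U.isPrefix E' ∧
  ∀ M : Set P, N.reach M₀ M →
    ∃ C : Set E, U.occ.config C ∧ C ⊆ E' ∧ U.Mark C = M ∧
      ∀ t : T, N.enabled M t → ∃ e ∈ E', U.fE e = t ∧ U.occ.enabledBy C e

/-- `isPi1 E₀ E₁`: `E₀` is a complete prefix `Π₀` and `E₁` is the prefix `Π₁`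
obtained by appending, after every `⊆`-maximal configuration `Cm` of `Π₀`, a
complete prefix of the unfolding of `(N, Mark Cm)`. -/
def isPi1 (E₀ E₁ : Set E) : Prop :=
  U.isCompletePrefix E₀ ∧ U.isPrefix E₁ ∧ E₀ ⊆ E₁ ∧
  ∀ Cm : Set E, U.occ.config Cm → Cm ⊆ E₀ →
    (∀ C' : Set E, U.occ.config C' → C' ⊆ E₀ → Cm ⊆ C' → C' = Cm) →
    ∀ M : Set P, N.reach (U.Mark Cm) M →
      ∃ C : Set E, U.occ.config C ∧ Cm ⊆ C ∧ C ⊆ E₁ ∧ U.Mark C = M ∧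
        ∀ t : T, N.enabled M t → ∃ e ∈ E₁, U.fE e = t ∧ U.occ.enabledBy C e

end Unfolding

namespace Net

variable {P T : Type} {N : Net P T}

theorem ltN.exists_producer {x : P ⊕ T} {p : P} (h : N.ltN x (Sum.inl p)) :
    ∃ t, N.tp t p ∧ N.leN x (Sum.inr t) := by
  rcases Relation.TransGen.tail'_iff.mp h with ⟨y, hxy, hy⟩
  rcases y with q | t
  · exact hy.elim
  · refine ⟨t, hy, ?_⟩
    rcases Relation.reflTransGen_iff_eq_or_transGen.mp hxy with h | h
    · exact Or.inr h.symm
    · exact Or.inl h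

theorem ltN.exists_consumer {x : P ⊕ T} {p : P} (h : N.ltN (Sum.inl p) x) :
    ∃ t, N.pt p t ∧ N.leN (Sum.inr t) x := by
  rcases Relation.TransGen.head'_iff.mp h with ⟨y, hy, hyx⟩
  rcases y with q | t
  · exact hy.elim
  · refine ⟨t, hy, ?_⟩
    rcases Relation.reflTransGen_iff_eq_or_transGen.mp hyx with h | h
    · exact Or.inr h.symm
    · exact Or.inl h

theorem ltN.exists_pre {x t : T} (h : N.ltN (Sum.inr x) (Sum.inr t)) :
    ∃ p, N.pt p t ∧ N.ltN (Sum.inr x) (Sum.inl p) := by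
  rcases Relation.TransGen.tail'_iff.mp h with ⟨y, hxy, hy⟩
  rcases y with q | t
  · refine ⟨q, hy, ?_⟩
    rcases Relation.reflTransGen_iff_eq_or_transGen.mp hxy with h | h
    · cases h
    · exact h
  · exact hy.elim

theorem leN.trans_ltN {x y z : P ⊕ T} (h : N.leN x y) (h' : N.ltN y z) : N.ltN x z := by
  rcases h with h | rfl
  · exact Relation.TransGen.trans h h'
  · exact h'

theorem ltN.of_tp_pt {s t : T} {p : P} (h : N.tp s p) (h' : N.pt p t) :
    N.ltN (Sum.inr s) (Sum.inr t) :=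
  Relation.TransGen.tail (Relation.TransGen.single (show N.edge (Sum.inr s) (Sum.inl p) from h))
    (show N.edge (Sum.inl p) (Sum.inr t) from h')

theorem conflict.symm {x y : P ⊕ T} (h : N.conflict x y) : N.conflict y x := by
  obtain ⟨u, v, huv, hu, hv, p, hp⟩ := h
  exact ⟨v, u, huv.symm, hv, hu, p, hp.2, hp.1⟩

theorem dirConflict.conflict {u v : T} (h : N.dirConflict u v) (huv : u ≠ v) :
    N.conflict (Sum.inr u) (Sum.inr v) :=
  ⟨u, v, huv, Or.inr rfl, Or.inr rfl, h⟩

theorem FiringSeq.concat {M M' : Set P} {l : List T} (h : N.FiringSeq M l M') {t : T}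
    (ht : N.enabled M' t) : N.FiringSeq M (l ++ [t]) (N.fire M' t) := by
  induction h with
  | nil M => exact .cons t ht (.nil _)
  | cons s hs _ ih => exact .cons s hs (ih ht)

/-- In a safe net, a transition with empty preset has empty postset, so firing it changes
nothing. -/
theorem fire_eq_self_of_preT_eq_empty {M₀ M : Set P} (hsafe : N.safe M₀) (hM : N.reach M₀ M)
    {t : T} (ht : N.preT t = ∅) : N.fire M t = M := by
  have hen (M : Set P) : N.enabled M t := by simp [enabled, ht]
  have h := hsafe (N.fire M t) (hM.tail ⟨t, hen M, rfl⟩) t (hen _)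
  have hpost : N.postT t = ∅ :=
    Set.subset_empty_iff.mp fun p hp => ht ▸ h ⟨Or.inr hp, hp⟩
  simp [fire, ht, hpost]

end Net

namespace OccNet

variable {B E : Type} {O : OccNet B E}

theorem config.mem_of_leN {C : Set E} (hC : O.config C) {x e : E} (he : e ∈ C)
    (h : O.toNet.leN (Sum.inr x) (Sum.inr e)) : x ∈ C := by
  rcases h with h | h
  · exact hC.1 e he x h
  · cases h; exact he

theorem config.eq_of_common_pre {C : Set E} (hC : O.config C) {e e' : E} (he : e ∈ C)
    (he' : e' ∈ C) {b : B} (hb : O.toNet.pt b e) (hb' : O.toNet.pt b e') : e = e' := by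
  by_contra hne
  exact hC.2 e he e' he' (Net.dirConflict.conflict ⟨b, hb, hb'⟩ hne)

theorem config.subset_of_causallyClosed {C D : Set E} (hC : O.config C) (hDC : D ⊆ C)
    (hD : ∀ e ∈ D, ∀ e', O.toNet.ltN (Sum.inr e') (Sum.inr e) → e' ∈ D) : O.config D :=
  ⟨hD, fun e he e' he' => hC.2 e (hDC he) e' (hDC he')⟩

theorem config_empty : O.config ∅ := ⟨by simp, by simp⟩

theorem mem_of_ltN_of_mem_cut {C : Set E} (hC : O.config C) {b : B} (hb : b ∈ O.cut C) {x : E}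
    (h : O.toNet.ltN (Sum.inr x) (Sum.inl b)) : x ∈ C := by
  obtain ⟨t, ht, hxt⟩ := h.exists_producer
  rcases hb.1 with h0 | ⟨e, he, heb⟩
  · have := (O.mem_c₀_iff b).mp h0
    exact absurd (show t ∈ O.toNet.preP b from ht) (by simp [this])
  · rw [O.pre_subsingleton b (show t ∈ O.toNet.preP b from ht) heb] at hxt
    exact hC.mem_of_leN he hxt

theorem coset_cut {C : Set E} (hC : O.config C) : O.toNet.coset (O.cut C) := by
  have hle : ∀ b ∈ O.cut C, ∀ b' ∈ O.cut C, b ≠ b' →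
      ¬ O.toNet.leN (Sum.inl b) (Sum.inl b') := by
    intro b hb b' hb' hne h
    rcases h with h | h
    · obtain ⟨t, hbt, htb'⟩ := h.exists_consumer
      rcases htb' with htb' | htb'
      · exact hb.2 ⟨t, mem_of_ltN_of_mem_cut hC hb' htb', hbt⟩
      · cases htb'
    · exact hne (Sum.inl_injective h)
  intro b hb b' hb' hne
  refine ⟨hle b hb b' hb' hne, hle b' hb' b hb hne.symm, ?_⟩
  rintro ⟨u, v, huv, hu, hv, huv'⟩
  rcases hu with hu | hu
  · rcases hv with hv | hv
    · exact hC.2 u (mem_of_ltN_of_mem_cut hC hb hu) v (mem_of_ltN_of_mem_cut hC hb' hv)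
        (huv'.conflict huv)
    · cases hv
  · cases hu

theorem config_union_singleton {C : Set E} (hC : O.config C) {e : E}
    (he : O.toNet.preT e ⊆ O.cut C) : O.config (C ∪ {e}) := by
  have hpast : ∀ x, O.toNet.ltN (Sum.inr x) (Sum.inr e) → x ∈ C := by
    intro x hx
    obtain ⟨b, hbe, hxb⟩ := hx.exists_pre
    exact mem_of_ltN_of_mem_cut hC (he hbe) hxb
  have hconf : ∀ x ∈ C, ¬ O.toNet.conflict (Sum.inr e) (Sum.inr x) := by
    rintro x hx ⟨u, v, huv, hu, hv, huv'⟩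
    have hvC := hC.mem_of_leN hx hv
    rcases hu with hu | hu
    · exact hC.2 u (hpast u hu) v hvC (huv'.conflict huv)
    · cases hu
      obtain ⟨b, hb, hb'⟩ := huv'
      exact (he hb).2 ⟨v, hvC, hb'⟩
  constructor
  · rintro x (hx | rfl) y hy
    · exact Or.inl (hC.1 x hx y hy)
    · exact Or.inl (hpast y hy)
  · rintro x (hx | rfl) y (hy | rfl)
    · exact hC.2 x hx y hy
    · exact fun h => hconf x hx h.symm
    · exact hconf y hy
    · exact O.no_self_conflict _

theorem enabledBy.preT_subset_cut {C : Set E} {e : E} (h : O.enabledBy C e) :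
    O.toNet.preT e ⊆ O.cut C := by
  obtain ⟨heC, hC⟩ := h
  have he : e ∈ C ∪ {e} := Or.inr rfl
  intro b hb
  refine ⟨?_, ?_⟩
  · by_cases h0 : b ∈ O.c₀
    · exact Or.inl h0
    · rw [O.mem_c₀_iff, ← ne_eq, ← Set.nonempty_iff_ne_empty] at h0
      obtain ⟨x, hx⟩ := h0
      have hlt := Net.ltN.of_tp_pt (N := O.toNet) hx hb
      rcases hC.1 e he x hlt with h | h
      · exact Or.inr ⟨x, h, hx⟩
      · cases h
        exact (O.lt_irrefl _ hlt).elim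
  · rintro ⟨x, hx, hbx⟩
    exact heC (hC.eq_of_common_pre (Or.inl hx) he hbx hb ▸ hx)

theorem enabledBy.cut_union {C : Set E} {e : E} (hC : O.config C) (h : O.enabledBy C e) :
    O.cut (C ∪ {e}) = (O.cut C \ O.toNet.preT e) ∪ O.toNet.postT e := by
  ext b
  constructor
  · rintro ⟨hb, hb'⟩
    have h1 : ¬ ∃ x ∈ C, O.toNet.pt b x := fun ⟨x, hx, hbx⟩ => hb' ⟨x, Or.inl hx, hbx⟩
    have h2 : ¬ O.toNet.pt b e := fun hbe => hb' ⟨e, Or.inr rfl, hbe⟩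
    rcases hb with hb | ⟨x, hx | rfl, hxb⟩
    · exact Or.inl ⟨⟨Or.inl hb, h1⟩, h2⟩
    · exact Or.inl ⟨⟨Or.inr ⟨x, hx, hxb⟩, h1⟩, h2⟩
    · exact Or.inr hxb
  · rintro (⟨⟨hb, hb'⟩, hbe⟩ | hb)
    · refine ⟨hb.imp_right fun ⟨x, hx, hxb⟩ => ⟨x, Or.inl hx, hxb⟩, ?_⟩
      rintro ⟨x, hx | rfl, hbx⟩
      · exact hb' ⟨x, hx, hbx⟩
      · exact hbe hbx
    · refine ⟨Or.inr ⟨e, Or.inr rfl, hb⟩, ?_⟩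
      rintro ⟨x, hx, hbx⟩
      have hlt := Net.ltN.of_tp_pt (N := O.toNet) hb hbx
      rcases hx with hx | rfl
      · exact h.1 (hC.1 x hx e hlt)
      · exact O.lt_irrefl _ hlt

theorem finite_event_past (e : E) : {x : E | O.toNet.leN (Sum.inr x) (Sum.inr e)}.Finite :=
  (O.finite_past e).preimage Sum.inr_injective.injOn

theorem exists_minimal_event {S : Set E} (hS : S.Nonempty) :
    ∃ e ∈ S, ∀ x ∈ S, ¬ O.toNet.ltN (Sum.inr x) (Sum.inr e) := by
  obtain ⟨e, he, hmin⟩ := (measure fun e : E =>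
    {x : E | O.toNet.leN (Sum.inr x) (Sum.inr e)}.ncard).wf.has_min S hS
  refine ⟨e, he, fun x hx hlt => hmin x hx ?_⟩
  refine Set.ncard_lt_ncard ⟨fun y hy => Or.inl (hy.trans_ltN hlt), fun hsub => ?_⟩
    (finite_event_past e)
  have hex : O.toNet.leN (Sum.inr e) (Sum.inr x) := hsub (Or.inr rfl)
  exact O.lt_irrefl _ (hex.trans_ltN hlt)

/-- A configuration properly extended by another one enables one of the additional events. -/
theorem exists_enabledBy_of_ssubset {C D : Set E} (hC : O.config C) (hD : O.config D)
    (hCD : C ⊂ D) : ∃ e ∈ D, O.enabledBy C e := by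
  obtain ⟨e, ⟨heD, heC⟩, hmin⟩ :=
    exists_minimal_event (O := O) (Set.nonempty_of_ssubset hCD)
  refine ⟨e, heD, heC, hD.subset_of_causallyClosed
    (Set.union_subset hCD.1 (Set.singleton_subset_iff.mpr heD)) ?_⟩
  rintro x (hx | rfl) y hy
  · exact Or.inl (hC.1 x hx y hy)
  · by_contra hyC
    exact hmin y ⟨hD.1 x heD y hy, fun h => hyC (Or.inl h)⟩ hy

theorem config_induction {C D : Set E} (hC : O.config C) (hD : O.config D) (hfin : D.Finite)
    (hCD : C ⊆ D) {motive : Set E → Prop} (base : motive C)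
    (step : ∀ X e, O.config X → X.Finite → O.enabledBy X e → motive X → motive (X ∪ {e})) :
    motive D := by
  induction hn : (D \ C).ncard using Nat.strong_induction_on generalizing C with
  | _ n ih =>
    rcases hCD.eq_or_ssubset with rfl | hss
    · exact base
    obtain ⟨e, heD, he⟩ := exists_enabledBy_of_ssubset hC hD hss
    refine ih _ ?_ he.2 (Set.union_subset hCD (Set.singleton_subset_iff.mpr heD))
      (step C e hC (hfin.subset hCD) he base) rfl
    rw [← hn]
    refine Set.ncard_lt_ncard ⟨fun x hx => ⟨hx.1, fun h => hx.2 (Or.inl h)⟩, fun hsub => ?_⟩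
      (hfin.sdiff)
    exact (hsub ⟨heD, he.1⟩).2 (Or.inr rfl)

/-- Every finite set of events of a configuration lies in a finite sub-configuration. -/
theorem config.exists_finite_config {C F : Set E} (hC : O.config C) (hF : F.Finite)
    (hFC : F ⊆ C) : ∃ D, D.Finite ∧ O.config D ∧ F ⊆ D ∧ D ⊆ C := by
  have hsub : (⋃ e ∈ F, {x : E | O.toNet.leN (Sum.inr x) (Sum.inr e)}) ⊆ C := by
    intro x hx
    simp only [Set.mem_iUnion, Set.mem_ofPred_eq] at hx
    obtain ⟨e, he, hxe⟩ := hx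
    exact hC.mem_of_leN (hFC he) hxe
  refine ⟨_, hF.biUnion fun e _ => finite_event_past (O := O) e,
    hC.subset_of_causallyClosed hsub ?_, ?_, hsub⟩
  · intro e he x hxe
    simp only [Set.mem_iUnion, Set.mem_ofPred_eq] at he ⊢
    obtain ⟨y, hy, hey⟩ := he
    refine ⟨y, hy, ?_⟩
    rcases hey with hey | hey
    · exact Or.inl (Relation.TransGen.trans hxe hey)
    · exact Or.inl (hey ▸ hxe)
  · intro e he
    simp only [Set.mem_iUnion, Set.mem_ofPred_eq]
    exact ⟨e, he, Or.inr rfl⟩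

theorem config_iUnion {C : ℕ → Set E} (hC : ∀ n, O.config (C n)) (hmono : Monotone C) :
    O.config (⋃ n, C n) := by
  constructor
  · intro e he x hx
    obtain ⟨n, hn⟩ := Set.mem_iUnion.mp he
    exact Set.mem_iUnion.mpr ⟨n, (hC n).1 e hn x hx⟩
  · intro e he e' he'
    obtain ⟨n, hn⟩ := Set.mem_iUnion.mp he
    obtain ⟨m, hm⟩ := Set.mem_iUnion.mp he'
    exact (hC (max n m)).2 e (hmono (le_max_left n m) hn) e' (hmono (le_max_right n m) hm)

/-- An event enabled by a sub-configuration of a run that does not occur in the run is in direct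
conflict with an event of the run. -/
theorem run.exists_spoiler_of_notMem {ω C : Set E} (hω : O.run ω) (hCω : C ⊆ ω) {e : E}
    (he : O.toNet.preT e ⊆ O.cut C) (heω : e ∉ ω) : ∃ e' ∈ ω, O.spoiler e e' := by
  by_contra! hno
  have hcut : O.toNet.preT e ⊆ O.cut ω := fun b hb =>
    ⟨(he hb).1.imp_right fun ⟨x, hx, hxb⟩ => ⟨x, hCω hx, hxb⟩,
      fun ⟨x, hx, hbx⟩ => hno x hx ⟨b, hbx, hb⟩⟩
  have := hω.2 _ (config_union_singleton hω.1 hcut) Set.subset_union_left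
  exact heω (this ▸ Or.inr rfl)

end OccNet

namespace Unfolding

variable {P T B E : Type} {N : Net P T} {M₀ : Set P} {U : Unfolding P T N M₀ B E}

theorem enabled_of_preT_subset_cut {C : Set E} {e : E} (h : U.occ.toNet.preT e ⊆ U.occ.cut C) :
    N.enabled (U.Mark C) (U.fE e) := by
  rw [Net.enabled, ← (U.pre_bij e).image_eq]
  exact Set.image_mono h

theorem Mark_union_singleton {C : Set E} {e : E} (hC : U.occ.config C)
    (hinj : Set.InjOn U.fB (U.occ.cut C)) (h : U.occ.enabledBy C e) :
    U.Mark (C ∪ {e}) = N.fire (U.Mark C) (U.fE e) := by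
  rw [Mark, h.cut_union hC, Set.image_union, (U.post_bij e).image_eq, Net.fire,
    hinj.image_sdiff_subset h.preT_subset_cut, (U.pre_bij e).image_eq, Mark]

theorem reach_Mark_and_injOn_cut (hsafe : N.safe M₀) {C : Set E} (hfin : C.Finite)
    (hC : U.occ.config C) : N.reach M₀ (U.Mark C) ∧ Set.InjOn U.fB (U.occ.cut C) := by
  refine OccNet.config_induction OccNet.config_empty hC hfin (Set.empty_subset C)
    (motive := fun C => N.reach M₀ (U.Mark C) ∧ Set.InjOn U.fB (U.occ.cut C)) ?_ ?_
  · have h0 : U.occ.cut ∅ = U.occ.c₀ := by simp [OccNet.cut]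
    rw [Mark, h0, U.init_bij.image_eq]
    exact ⟨Relation.ReflTransGen.refl, U.init_bij.injOn⟩
  · rintro X e hX - he ⟨hreach, hinj⟩
    have hpre := he.preT_subset_cut
    have hen := enabled_of_preT_subset_cut hpre
    refine ⟨hreach.tail ⟨_, hen, Mark_union_singleton hX hinj he⟩, ?_⟩
    rw [he.cut_union hX]
    have key : ∀ x ∈ U.occ.cut X \ U.occ.toNet.preT e, ∀ y ∈ U.occ.toNet.postT e,
        U.fB x ≠ U.fB y := by
      intro x hx y hy hxy
      have hmem : U.fB x ∈ N.preT (U.fE e) :=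
        hsafe _ hreach _ hen ⟨⟨x, hx.1, rfl⟩, hxy ▸ (U.post_bij e).mapsTo hy⟩
      obtain ⟨z, hz, hzx⟩ := (U.pre_bij e).surjOn hmem
      exact hx.2 (hinj (hpre hz) hx.1 hzx ▸ hz)
    rintro x (hx | hx) y (hy | hy) hxy
    · exact hinj hx.1 hy.1 hxy
    · exact (key x hx y hy hxy).elim
    · exact (key y hy x hx hxy.symm).elim
    · exact (U.post_bij e).injOn hx hy hxy

theorem injOn_cut (hsafe : N.safe M₀) {C : Set E} (hfin : C.Finite) (hC : U.occ.config C) :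
    Set.InjOn U.fB (U.occ.cut C) :=
  (reach_Mark_and_injOn_cut hsafe hfin hC).2

/-- The events between two nested finite configurations can be fired sequentially. -/
theorem exists_firingSeq (hsafe : N.safe M₀) {C D : Set E} (hC : U.occ.config C)
    (hD : U.occ.config D) (hfin : D.Finite) (hCD : C ⊆ D) :
    ∃ l, N.FiringSeq (U.Mark C) l (U.Mark D) ∧ ∀ e ∈ D, e ∉ C → U.fE e ∈ l := by
  refine OccNet.config_induction hC hD hfin hCD
    (motive := fun D => ∃ l, N.FiringSeq (U.Mark C) l (U.Mark D) ∧
      ∀ e ∈ D, e ∉ C → U.fE e ∈ l) ⟨[], .nil _, fun e he h => (h he).elim⟩ ?_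
  rintro X e hX hXfin he ⟨l, hl, hmem⟩
  refine ⟨l ++ [U.fE e], ?_, ?_⟩
  · rw [Mark_union_singleton hX (injOn_cut hsafe hXfin hX) he]
    exact hl.concat (enabled_of_preT_subset_cut he.preT_subset_cut)
  · rintro x (hx | rfl) hxC
    · exact List.mem_append_left _ (hmem x hx hxC)
    · simp

theorem reach_Mark_of_subset (hsafe : N.safe M₀) {C D : Set E} (hC : U.occ.config C)
    (hD : U.occ.config D) (hfin : D.Finite) (hCD : C ⊆ D) :
    N.reach (U.Mark C) (U.Mark D) := by
  refine OccNet.config_induction hC hD hfin hCD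
    (motive := fun D => N.reach (U.Mark C) (U.Mark D)) Relation.ReflTransGen.refl ?_
  intro X e hX hXfin he h
  exact h.tail ⟨_, enabled_of_preT_subset_cut he.preT_subset_cut,
    Mark_union_singleton hX (injOn_cut hsafe hXfin hX) he⟩

theorem exists_event_of_enabled (hsafe : N.safe M₀) {C : Set E} (hfin : C.Finite)
    (hC : U.occ.config C) {t : T} (ht : N.enabled (U.Mark C) t) :
    ∃ e, U.occ.toNet.preT e ⊆ U.occ.cut C ∧ U.fE e = t := by
  obtain ⟨e, he, het⟩ := U.event_exists {b ∈ U.occ.cut C | U.fB b ∈ N.preT t} t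
    (fun b hb b' hb' => OccNet.coset_cut hC b hb.1 b' hb'.1)
    ⟨fun b hb => hb.2, (injOn_cut hsafe hfin hC).mono fun b hb => hb.1, fun p hp => by
      obtain ⟨b, hb, rfl⟩ := ht hp
      exact ⟨b, ⟨hb, hp⟩, rfl⟩⟩
  exact ⟨e, he ▸ fun b hb => hb.1, het⟩

theorem finite_setOf_preT_subset_cut [Finite T] (hsafe : N.safe M₀) {C : Set E}
    (hfin : C.Finite) (hC : U.occ.config C) :
    {e | U.occ.toNet.preT e ⊆ U.occ.cut C}.Finite := by
  refine Set.Finite.of_finite_image (f := U.fE) (Set.toFinite _) fun e he e' he' hee' => ?_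
  refine U.event_unique e e' ?_ hee'
  refine (injOn_cut hsafe hfin hC).image_eq_image_iff he he' |>.mp ?_
  rw [(U.pre_bij e).image_eq, (U.pre_bij e').image_eq, hee']

/-- A firing sequence from the marking of a finite configuration lifts to an extension of this
configuration, which consumes the conditions of the cut whose places are consumed by the
sequence. -/
theorem exists_config_of_firingSeq (hsafe : N.safe M₀) {M M' : Set P} {l : List T}
    (h : N.FiringSeq M l M') : ∀ {C : Set E}, C.Finite → U.occ.config C → U.Mark C = M →
    ∃ D, D.Finite ∧ U.occ.config D ∧ C ⊆ D ∧ U.Mark D = M' ∧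
      ∀ b ∈ U.occ.cut C, (∃ t ∈ l, U.fB b ∈ N.preT t) → ∃ e ∈ D, b ∈ U.occ.toNet.preT e := by
  induction h with
  | nil M =>
    intro C hfin hC hM
    exact ⟨C, hfin, hC, subset_rfl, hM, by simp⟩
  | @cons M t l M' ht _ ih =>
    rintro C hfin hC rfl
    have hinj := injOn_cut hsafe hfin hC
    obtain ⟨e, hpre, rfl⟩ := exists_event_of_enabled hsafe hfin hC ht
    have hconf := OccNet.config_union_singleton hC hpre
    have hMark : U.Mark (C ∪ {e}) = N.fire (U.Mark C) (U.fE e) := by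
      by_cases heC : e ∈ C
      · have hempty : U.occ.toNet.preT e = ∅ :=
          Set.subset_empty_iff.mp fun b hb => (hpre hb).2 ⟨e, heC, hb⟩
        have hN : N.preT (U.fE e) = ∅ := by rw [← (U.pre_bij e).image_eq, hempty, Set.image_empty]
        rw [Net.fire_eq_self_of_preT_eq_empty hsafe
            (reach_Mark_and_injOn_cut hsafe hfin hC).1 hN,
          Set.union_eq_left.mpr (Set.singleton_subset_iff.mpr heC)]
      · exact Mark_union_singleton hC hinj ⟨heC, hconf⟩
    obtain ⟨D, hDfin, hD, hsub, hDM, hcons⟩ := ih (hfin.union (Set.finite_singleton e)) hconf hMark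
    refine ⟨D, hDfin, hD, Set.subset_union_left.trans hsub, hDM, ?_⟩
    rintro b hb ⟨t, htl, hbt⟩
    by_cases hbe : b ∈ U.occ.toNet.preT e
    · exact ⟨e, hsub (Or.inr rfl), hbe⟩
    refine hcons b ⟨hb.1.imp_right fun ⟨x, hx, hxb⟩ => ⟨x, Or.inl hx, hxb⟩, ?_⟩ ?_
    · rintro ⟨x, hx | rfl, hbx⟩
      · exact hb.2 ⟨x, hx, hbx⟩
      · exact hbe hbx
    · rcases List.mem_cons.mp htl with rfl | htl
      · obtain ⟨z, hz, hzb⟩ := (U.pre_bij e).surjOn hbt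
        exact (hbe (hinj (hpre hz) hb hzb ▸ hz)).elim
      · exact ⟨t, htl, hbt⟩

/-- Some marking occurs cofinally among the finite sub-configurations of a configuration. -/
theorem exists_recurrent_Mark [Finite P] {ω : Set E} (hω : U.occ.config ω) :
    ∃ M : Set P, ∀ F ⊆ ω, F.Finite →
      ∃ D, D.Finite ∧ U.occ.config D ∧ F ⊆ D ∧ D ⊆ ω ∧ U.Mark D = M := by
  by_contra! hno
  choose F hFω hFfin hF using hno
  obtain ⟨D, hDfin, hD, hsub, hDω⟩ := hω.exists_finite_config
    (Set.finite_iUnion hFfin) (Set.iUnion_subset hFω)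
  exact hF (U.Mark D) D hDfin hD ((Set.subset_iUnion F _).trans hsub) hDω rfl

/-- A non-doomed configuration extends to two nested configurations with the same non-bad marking
such that all events enabled by the first are spoiled in the second. -/
theorem free.exists_loop [Finite P] [Finite T] (hsafe : N.safe M₀) {Bad : Set (Set P)}
    {C : Set E} (hfin : C.Finite) (hC : U.occ.config C) (hfree : U.free Bad C) :
    ∃ C₁ C₂ : Set E, C₁.Finite ∧ C₂.Finite ∧ U.occ.config C₁ ∧ U.occ.config C₂ ∧
      C ⊆ C₁ ∧ C₁ ⊆ C₂ ∧ U.Mark C₂ ∉ Bad ∧ U.Mark C₁ = U.Mark C₂ ∧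
      ∀ e : E, U.occ.enabledBy C₁ e → ∃ e' ∈ C₂, U.occ.spoiler e e' := by
  rw [free, doomed] at hfree
  push Not at hfree
  obtain ⟨ω, hω, hCω, hgood⟩ := hfree
  obtain ⟨M, hM⟩ := exists_recurrent_Mark hω.1
  have hsources : {e | e ∈ ω ∧ U.occ.toNet.preT e = ∅}.Finite :=
    (finite_setOf_preT_subset_cut hsafe hfin hC).subset fun e he b hb =>
      absurd hb (by simp [he.2])
  obtain ⟨C₁, hfin₁, hC₁, hsub₁, hC₁ω, hM₁⟩ := hM _
    (Set.union_subset hCω fun e (he : e ∈ ω ∧ _) => he.1) (hfin.union hsources)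
  have hspoil : ∀ e, U.occ.enabledBy C₁ e → ∃ e' ∈ ω, U.occ.spoiler e e' := by
    intro e he
    by_cases heω : e ∈ ω
    · refine ⟨e, heω, ?_⟩
      rw [OccNet.spoiler, Set.inter_self, Set.nonempty_iff_ne_empty]
      exact fun hempty => he.1 (hsub₁ (Or.inr ⟨heω, hempty⟩))
    · exact hω.exists_spoiler_of_notMem hC₁ω he.preT_subset_cut heω
  choose! g hgω hg using hspoil
  have henfin : {e | U.occ.enabledBy C₁ e}.Finite :=
    (finite_setOf_preT_subset_cut hsafe hfin₁ hC₁).subset fun e he =>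
      OccNet.enabledBy.preT_subset_cut he
  obtain ⟨C₂, hfin₂, hC₂, hsub₂, hC₂ω, hM₂⟩ := hM (C₁ ∪ g '' {e | U.occ.enabledBy C₁ e})
    (Set.union_subset hC₁ω (Set.image_subset_iff.mpr hgω)) (hfin₁.union (henfin.image g))
  have hCC₁ : C ⊆ C₁ := Set.subset_union_left.trans hsub₁
  have hC₁C₂ : C₁ ⊆ C₂ := Set.subset_union_left.trans hsub₂
  exact ⟨C₁, C₂, hfin₁, hfin₂, hC₁, hC₂, hCC₁, hC₁C₂,
    hgood C₂ hfin₂ hC₂ (hCC₁.trans hC₁C₂) hC₂ω, hM₁.trans hM₂.symm,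
    fun e he => ⟨g e, hsub₂ (Or.inr ⟨e, he, rfl⟩), hg e he⟩⟩

/-- Repeating a loop that spoils all events enabled at its start yields a run without bad
finite configurations. -/
theorem free_of_loop (hsafe : N.safe M₀) {Bad : Set (Set P)} (hBad : ReachClosed N Bad)
    {C C₁ C₂ : Set E} (hfin₁ : C₁.Finite) (hfin₂ : C₂.Finite) (hC₁ : U.occ.config C₁)
    (hC₂ : U.occ.config C₂) (hCC₁ : C ⊆ C₁) (hC₁C₂ : C₁ ⊆ C₂) (hgood : U.Mark C₂ ∉ Bad)
    (hMark : U.Mark C₁ = U.Mark C₂)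
    (hspoil : ∀ e : E, U.occ.enabledBy C₁ e → ∃ e' ∈ C₂, U.occ.spoiler e e') :
    U.free Bad C := by
  obtain ⟨l, hl, hlmem⟩ := exists_firingSeq hsafe hC₁ hC₂ hfin₂ hC₁C₂
  rw [← hMark] at hl hgood
  have hlspoil : ∀ t, N.enabled (U.Mark C₁) t → (N.preT t).Nonempty →
      ∃ t' ∈ l, (N.preT t ∩ N.preT t').Nonempty := by
    rintro _ ht ⟨p, hp⟩
    obtain ⟨e, hpre, rfl⟩ := exists_event_of_enabled hsafe hfin₁ hC₁ ht
    obtain ⟨z, hz, -⟩ := (U.pre_bij e).surjOn hp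
    have heC₁ : e ∉ C₁ := fun he => (hpre hz).2 ⟨e, he, hz⟩
    obtain ⟨e', he', b, hb', hb⟩ := hspoil e ⟨heC₁, OccNet.config_union_singleton hC₁ hpre⟩
    exact ⟨U.fE e', hlmem e' he' fun h => (hpre hb).2 ⟨e', h, hb'⟩, U.fB b,
      (U.pre_bij e).mapsTo hb, (U.pre_bij e').mapsTo hb'⟩
  have hstep : ∀ D : {D : Set E // D.Finite ∧ U.occ.config D ∧ U.Mark D = U.Mark C₁},
      ∃ D' : {D : Set E // D.Finite ∧ U.occ.config D ∧ U.Mark D = U.Mark C₁}, D.1 ⊆ D'.1 ∧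
        ∀ b ∈ U.occ.cut D.1, (∃ t ∈ l, U.fB b ∈ N.preT t) →
          ∃ e ∈ D'.1, b ∈ U.occ.toNet.preT e := by
    rintro ⟨D, hDfin, hD, hDM⟩
    obtain ⟨D', h1, h2, h3, h4, h5⟩ := exists_config_of_firingSeq hsafe hl hDfin hD hDM
    exact ⟨⟨D', h1, h2, h4⟩, h3, h5⟩
  choose next hnext hcons using hstep
  let K : ℕ → {D : Set E // D.Finite ∧ U.occ.config D ∧ U.Mark D = U.Mark C₁} :=
    fun n => next^[n] ⟨C₁, hfin₁, hC₁, rfl⟩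
  have hK (n : ℕ) : K (n + 1) = next (K n) := Function.iterate_succ_apply' _ _ _
  have hmono : Monotone fun n => (K n).1 :=
    monotone_nat_of_le_succ fun n => by rw [hK]; exact hnext (K n)
  have hω := OccNet.config_iUnion (fun n => (K n).2.2.1) hmono
  have hbound : ∀ F : Set E, F.Finite → F ⊆ ⋃ n, (K n).1 → ∃ n, F ⊆ (K n).1 := by
    intro F hF hsub
    lift F to Finset E using hF
    exact Directed.exists_mem_subset_of_finset_subset_biUnion hmono.directed_le hsub
  have hCω : C₁ ⊆ ⋃ n, (K n).1 := Set.subset_iUnion (fun n => (K n).1) 0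
  have hmax : ∀ D, U.occ.config D → (⋃ n, (K n).1) ⊆ D → D = ⋃ n, (K n).1 := by
    intro D hD hωD
    by_contra hne
    obtain ⟨e, heD, heω, hconf⟩ := OccNet.exists_enabledBy_of_ssubset hω hD
      (hωD.ssubset_of_ne (Ne.symm hne))
    have hpast : {x : E | U.occ.toNet.leN (Sum.inr x) (Sum.inr e)} \ {e} ⊆ ⋃ n, (K n).1 := by
      rintro x ⟨hx, hxe⟩
      exact (hconf.mem_of_leN (Or.inr rfl) hx).resolve_right hxe
    obtain ⟨n, hn⟩ := hbound _ ((OccNet.finite_event_past e).sdiff) hpast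
    have hen : U.occ.enabledBy (K n).1 e := by
      refine ⟨fun h => heω (Set.mem_iUnion.mpr ⟨n, h⟩), hconf.subset_of_causallyClosed
        (Set.union_subset_union_left _ (Set.subset_iUnion (fun n => (K n).1) n)) ?_⟩
      rintro x (hx | rfl) y hy
      · exact Or.inl ((K n).2.2.1.1 x hx y hy)
      · refine Or.inl (hn ⟨Or.inl hy, ?_⟩)
        rintro rfl
        exact U.occ.lt_irrefl _ hy
    have hpre := hen.preT_subset_cut
    rcases (U.occ.toNet.preT e).eq_empty_or_nonempty with hempty | ⟨z, hz⟩
    · have heC₁ : e ∉ C₁ := fun h => heω (hCω h)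
      obtain ⟨e', -, b, -, hb⟩ := hspoil e
        ⟨heC₁, OccNet.config_union_singleton hC₁ (hempty ▸ Set.empty_subset _)⟩
      simp [hempty] at hb
    · have ht := enabled_of_preT_subset_cut hpre
      rw [(K n).2.2.2] at ht
      obtain ⟨t', ht', p, hp, hp'⟩ := hlspoil _ ht ⟨_, (U.pre_bij e).mapsTo hz⟩
      obtain ⟨b, hb, rfl⟩ := (U.pre_bij e).surjOn hp
      obtain ⟨e', he', hbe'⟩ := hcons (K n) b (hpre hb) ⟨t', ht', hp'⟩
      have he'ω : e' ∈ ⋃ n, (K n).1 := Set.mem_iUnion.mpr ⟨n + 1, by rwa [hK]⟩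
      exact heω (hD.eq_of_common_pre (hωD he'ω) heD hbe' hb ▸ he'ω)
  intro hdoomed
  obtain ⟨D, hDfin, hD, -, hDω, hDbad⟩ := hdoomed _ ⟨hω, hmax⟩ (hCC₁.trans hCω)
  obtain ⟨n, hn⟩ := hbound D hDfin hDω
  refine hgood ?_
  rw [← (K n).2.2.2]
  exact hBad _ hDbad _ (reach_Mark_of_subset hsafe hD (K n).2.2.1 (K n).2.1 hn)

end Unfolding

/-- Theorem 1 of the paper: a finite configuration `C` of the
unfolding `U` of a safe Petri net `(N,M₀)` is free iff (a) some finite maximal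
configuration `C' ⊇ C` has a non-bad marking, or (b) there are finite
configurations `C ⊆ C₁ ⊆ C₂` with `Mark C₂ ∉ Bad`, `Mark C₁ = Mark C₂`, and
every event enabled by `C₁` has a spoiler in `C₂`. -/
theorem free_iff_maximal_or_loop
    {P T B E : Type} [Finite P] [Finite T]
    (N : Net P T) (M₀ : Set P) (hsafe : N.safe M₀)
    (U : Unfolding P T N M₀ B E)
    (Bad : Set (Set P)) (hBad : ReachClosed N Bad)
    (C : Set E) (hfin : C.Finite) (hC : U.occ.config C) :
    U.free Bad C ↔
      ((∃ C' : Set E, C'.Finite ∧ U.occ.config C' ∧ C ⊆ C' ∧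
          (∀ C'' : Set E, U.occ.config C'' → C' ⊆ C'' → C'' = C') ∧
          U.Mark C' ∉ Bad)
       ∨ (∃ C₁ C₂ : Set E, C₁.Finite ∧ C₂.Finite ∧
            U.occ.config C₁ ∧ U.occ.config C₂ ∧
            C ⊆ C₁ ∧ C₁ ⊆ C₂ ∧ U.Mark C₂ ∉ Bad ∧
            U.Mark C₁ = U.Mark C₂ ∧
            (∀ e : E, U.occ.enabledBy C₁ e → ∃ e' ∈ C₂, U.occ.spoiler e e'))) := by
  constructor
  · exact fun hfree => Or.inr (hfree.exists_loop hsafe hfin hC)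
  · rintro (⟨C', hfin', hC', hsub, hmax, hgood⟩ |
      ⟨C₁, C₂, hfin₁, hfin₂, hC₁, hC₂, hsub₁, hsub₂, hgood, hMark, hspoil⟩)
    · refine Unfolding.free_of_loop hsafe hBad hfin' hfin' hC' hC' hsub subset_rfl hgood rfl ?_
      exact fun e he => (he.1 (hmax _ he.2 Set.subset_union_left ▸ Or.inr rfl)).elim
    · exact Unfolding.free_of_loop hsafe hBad hfin₁ hfin₂ hC₁ hC₂ hsub₁ hsub₂ hgood hMark hspoil
end

section
/- Let O be an occurrence net, C a finite configuration of O, and e∈crest(C) an unchallenged event. Then C':=C∖{e} is a finite configuration of O, and Ω_C = Ω_{C'}, i.e. a run of O contains C if and only if it contains C'. -/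
namespace OccNet

variable {B E : Type} {O : OccNet B E} {C ω : Set E} {e : E}

theorem config.diff_crest (hC : O.config C) (he : e ∈ O.crest C) : O.config (C \ {e}) := by
  refine ⟨fun f hf g hgf => ⟨hC.1 f hf.1 g hgf, ?_⟩, fun f hf g hg => hC.2 f hf.1 g hg.1⟩
  rintro rfl
  exact he.2 ⟨f, hf.1, hgf⟩

/-- An unchallenged event whose stump lies in a configuration is in conflict with none of
its events. -/
theorem config.not_conflict_of_unchallenged (hω : O.config ω) (hu : O.unchallenged e)
    (hs : O.stump e ⊆ ω) {f : E} (hf : f ∈ ω) :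
    ¬ O.toNet.conflict (Sum.inr e) (Sum.inr f) := by
  rintro ⟨u, v, huv, hue | hue, hvf, hd⟩
  · exact hω.2 u (hs hue) f hf ⟨u, v, huv, Or.inr rfl, hvf, hd⟩
  · cases hue
    exact hu ⟨v, huv.symm, Set.inter_comm _ _ ▸ hd⟩

theorem config.insert_of_unchallenged (hω : O.config ω) (hu : O.unchallenged e)
    (hs : O.stump e ⊆ ω) : O.config (insert e ω) := by
  constructor
  · rintro f (rfl | hf) g hgf
    · exact Or.inr (hs hgf)
    · exact Or.inr (hω.1 f hf g hgf)
  · rintro f (rfl | hf) g (rfl | hg)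
    · exact O.no_self_conflict _
    · exact hω.not_conflict_of_unchallenged hu hs hg
    · exact fun h => hω.not_conflict_of_unchallenged hu hs hf h.symm
    · exact hω.2 f hf g hg

theorem run.mem_of_unchallenged (hω : O.run ω) (hu : O.unchallenged e)
    (hs : O.stump e ⊆ ω) : e ∈ ω := by
  rw [← hω.2 _ (hω.1.insert_of_unchallenged hu hs) (Set.subset_insert e ω)]
  exact Set.mem_insert e ω

theorem config.stump_subset_diff (hC : O.config C) (he : e ∈ C) : O.stump e ⊆ C \ {e} := by
  refine fun g hg => ⟨hC.1 e he g hg, ?_⟩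
  rintro rfl
  exact O.lt_irrefl _ hg

end OccNet

/-- Lemma 3 of the paper: removing an unchallenged crest event `e`
from a finite configuration `C` yields a configuration `C' = C \ {e}` with the
same set of runs: a run contains `C` iff it contains `C'`. -/
theorem shave_unchallenged_crest
    {B E : Type} (O : OccNet B E)
    (C : Set E) (hfin : C.Finite) (hC : O.config C)
    (e : E) (he : e ∈ O.crest C) (hu : O.unchallenged e) :
    O.config (C \ {e}) ∧ (C \ {e}).Finite ∧
      (∀ ω : Set E, O.run ω → (C ⊆ ω ↔ C \ {e} ⊆ ω)) := by
  refine ⟨hC.diff_crest he, hfin.sdiff, fun ω hω => ⟨Set.sdiff_subset.trans, fun h f hf => ?_⟩⟩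
  by_cases hfe : f = e
  · exact hfe ▸ hω.mem_of_unchallenged hu ((hC.stump_subset_diff he.1).trans h)
  · exact h ⟨hf, hfe⟩
end

section
/- Let O be an occurrence net and e an unchallenged event of O. Every run ω of O that contains the stump ⌊e⌋={e':e'<e} of e also contains e itself. -/
/-- every run of an occurrence net that contains the stump
`⌊e⌋ = {e' : e' < e}` of an unchallenged event `e` also contains `e`. -/
theorem run_mem_of_unchallenged_stump
    {B E : Type} (O : OccNet B E)
    (e : E) (hu : O.unchallenged e)
    (ω : Set E) (hω : O.run ω) (hstump : O.stump e ⊆ ω) :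
    e ∈ ω := by
  have closed : ∀ x ∈ insert e ω, ∀ u : E,
      O.toNet.ltN (Sum.inr u) (Sum.inr x) → u ∈ insert e ω := by
    rintro x (rfl | hx) u hux
    · exact Or.inr (hstump hux)
    · exact Or.inr (hω.1.1 x hx u hux)
  have closed_le : ∀ x ∈ insert e ω, ∀ u : E,
      O.toNet.leN (Sum.inr u) (Sum.inr x) → u ∈ insert e ω := by
    rintro x hx u (hux | hux)
    · exact closed x hx u hux
    · exact Sum.inr_injective hux ▸ hx
  have hC : O.config (insert e ω) := by
    refine ⟨closed, ?_⟩
    rintro x hx y hy ⟨u, v, huv, hux, hvy, b, hbu, hbv⟩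
    rcases closed_le x hx u hux with rfl | hu'
    · exact hu ⟨v, huv.symm, b, hbv, hbu⟩
    rcases closed_le y hy v hvy with rfl | hv'
    · exact hu ⟨u, huv, b, hbu, hbv⟩
    exact hω.1.2 u hu' v hv' ⟨u, v, huv, Or.inr rfl, Or.inr rfl, b, hbu, hbv⟩
  exact hω.2 _ hC (Set.subset_insert e ω) ▸ Set.mem_insert e ω
end
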